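/- arXiv:math/0503348 — 5 statements merged into one kernel-verified Lean document; each statement's English description precedes it below -/
import Mathlib

section
/- Let U ⊆ ℂ be a connected open set, let a, μ : U → ℂ be holomorphic with a nowhere vanishing, and let f : U → U be holomorphic with nowhere-vanishing derivative such that a(f(x)) = a(x)·f′(x) for all x ∈ U (f preserves the vector field a·d/dx, e.g. f is a flow map of a·d/dx). If a″(x) + μ(x)·a′(x) + μ′(x)·a(x) = 0 for all x ∈ U, then f is a solution of the rank-two equation G₂(μ): μ(f(x))·f′(x) + f″(x)/f′(x) = μ(x) for all x ∈ U. -/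
/-- On a connected open set, `a′ + μ a` is a first integral of `a″ + μ a′ + μ′ a = 0`. -/
theorem deriv_add_mul_eq_of_A2 {U : Set ℂ} (hUopen : IsOpen U) (hUconn : IsPreconnected U)
    {a μ : ℂ → ℂ} (ha : DifferentiableOn ℂ a U) (hμ : DifferentiableOn ℂ μ U)
    (hA2 : ∀ x ∈ U, deriv (deriv a) x + μ x * deriv a x + deriv μ x * a x = 0)
    {x y : ℂ} (hx : x ∈ U) (hy : y ∈ U) :
    deriv a x + μ x * a x = deriv a y + μ y * a y := by
  have ha' := ha.deriv hUopen
  refine hUopen.is_const_of_deriv_eq_zero (f := fun z => deriv a z + μ z * a z) hUconn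
    (ha'.add (hμ.mul ha)) (fun z hz => ?_) hx hy
  have hnhds := hUopen.mem_nhds hz
  have hd := (ha'.differentiableAt hnhds).hasDerivAt.add
    ((hμ.differentiableAt hnhds).hasDerivAt.mul (ha.differentiableAt hnhds).hasDerivAt)
  refine hd.deriv.trans ?_
  rw [Pi.zero_apply]
  linear_combination hA2 z hz

/-- If `f` preserves the holomorphic nowhere-vanishing vector field
`a·d/dx` on a connected open `U ⊆ ℂ` (i.e. `a (f x) = a x · f′ x`) and `a` solves the
equation of the D-Lie algebra `A₂(μ)`, namely `a″ + μ a′ + μ′ a = 0`, then `f` is a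
solution of the rank-two equation `G₂(μ)`: `μ(f x)·f′ x + f″ x / f′ x = μ x` on `U`. -/
theorem flow_solution_of_G2
    (U : Set ℂ) (hUopen : IsOpen U) (hUconn : IsConnected U)
    (a μ f : ℂ → ℂ)
    (ha : DifferentiableOn ℂ a U) (hμ : DifferentiableOn ℂ μ U)
    (ha0 : ∀ x ∈ U, a x ≠ 0)
    (hf : DifferentiableOn ℂ f U) (hfmaps : Set.MapsTo f U U)
    (hf0 : ∀ x ∈ U, deriv f x ≠ 0)
    (hinv : ∀ x ∈ U, a (f x) = a x * deriv f x)
    (hA2 : ∀ x ∈ U, deriv (deriv a) x + μ x * deriv a x + deriv μ x * a x = 0) :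
    ∀ x ∈ U, μ (f x) * deriv f x + deriv (deriv f) x / deriv f x = μ x := by
  intro x hx
  have hnhds := hUopen.mem_nhds hx
  have hfx := (hf.differentiableAt hnhds).hasDerivAt
  have hafx := (ha.differentiableAt (hUopen.mem_nhds (hfmaps hx))).hasDerivAt.comp x hfx
  have hprod := (ha.differentiableAt hnhds).hasDerivAt.mul
    ((hf.deriv hUopen).differentiableAt hnhds).hasDerivAt
  have hderiv : deriv a (f x) * deriv f x = deriv a x * deriv f x + a x * deriv (deriv f) x :=
    hafx.unique (hprod.congr_of_eventuallyEq (Filter.eventually_of_mem hnhds hinv))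
  have hconst := deriv_add_mul_eq_of_A2 hUopen hUconn.isPreconnected ha hμ hA2 (hfmaps hx) hx
  rw [hinv x hx] at hconst
  have hf0x := hf0 x hx
  field_simp
  apply mul_left_cancel₀ (ha0 x hx)
  linear_combination deriv f x * hconst - hderiv
end

section
/- Let U ⊆ ℂ be a connected open set, let a, ν : U → ℂ be holomorphic with a nowhere vanishing, and let f : U → U be holomorphic with nowhere-vanishing derivative such that a(f(x)) = a(x)·f′(x) for all x ∈ U (f preserves the vector field a·d/dx, e.g. f is a flow map of a·d/dx). If a‴(x) + ν(x)·a′(x) + (ν′(x)/2)·a(x) = 0 for all x ∈ U, then f is a solution of the rank-three equation G₃(ν): ν(f(x))·f′(x)² + 2·f‴(x)/f′(x) − 3·(f″(x)/f′(x))² = ν(x) for all x ∈ U. -/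
/-- The first integral `2 a a″ - (a′)² + ν a²` of the equation `a‴ + ν a′ + (ν′/2) a = 0` has
zero derivative, hence takes the same value at any two points of a connected open set. -/
theorem first_integral_eq_of_A3 {U : Set ℂ} (hUopen : IsOpen U) (hUconn : IsPreconnected U)
    {a ν : ℂ → ℂ} (ha : DifferentiableOn ℂ a U) (hν : DifferentiableOn ℂ ν U)
    (hA3 : ∀ x ∈ U,
      deriv (deriv (deriv a)) x + ν x * deriv a x + (deriv ν x / 2) * a x = 0)
    {x y : ℂ} (hx : x ∈ U) (hy : y ∈ U) :
    2 * a x * deriv (deriv a) x - deriv a x ^ 2 + ν x * a x ^ 2 =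
      2 * a y * deriv (deriv a) y - deriv a y ^ 2 + ν y * a y ^ 2 := by
  have hasDeriv {g : ℂ → ℂ} (hg : DifferentiableOn ℂ g U) {z : ℂ} (hz : z ∈ U) :
      HasDerivAt g (deriv g z) z := (hg.differentiableAt (hUopen.mem_nhds hz)).hasDerivAt
  have ha₁ := ha.deriv hUopen
  have ha₂ := ha₁.deriv hUopen
  have hderiv : ∀ z ∈ U, HasDerivAt
      (fun z => 2 * a z * deriv (deriv a) z - deriv a z ^ 2 + ν z * a z ^ 2) 0 z := by
    intro z hz
    have h := ((((hasDeriv ha hz).const_mul 2).mul (hasDeriv ha₂ hz)).sub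
      ((hasDeriv ha₁ hz).pow 2)).add ((hasDeriv hν hz).mul ((hasDeriv ha hz).pow 2))
    refine h.congr_deriv ?_
    simp only [Pi.pow_apply]
    push_cast
    linear_combination (2 * a z) * hA3 z hz
  exact hUopen.is_const_of_deriv_eq_zero hUconn
    (fun z hz => (hderiv z hz).differentiableAt.differentiableWithinAt)
    (fun z hz => (hderiv z hz).deriv) hx hy

/-- If `f` preserves the holomorphic nowhere-vanishing vector field
`a·d/dx` on a connected open `U ⊆ ℂ` (i.e. `a (f x) = a x · f′ x`) and `a` solves the
equation of the D-Lie algebra `A₃(ν)`, namely `a‴ + ν a′ + (ν′/2) a = 0`, then `f` is a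
solution of the rank-three equation `G₃(ν)`:
`ν(f x)·(f′ x)² + 2 f‴ x / f′ x − 3 (f″ x / f′ x)² = ν x` on `U`. -/
theorem flow_solution_of_G3
    (U : Set ℂ) (hUopen : IsOpen U) (hUconn : IsConnected U)
    (a ν f : ℂ → ℂ)
    (ha : DifferentiableOn ℂ a U) (hν : DifferentiableOn ℂ ν U)
    (ha0 : ∀ x ∈ U, a x ≠ 0)
    (hf : DifferentiableOn ℂ f U) (hfmaps : Set.MapsTo f U U)
    (hf0 : ∀ x ∈ U, deriv f x ≠ 0)
    (hinv : ∀ x ∈ U, a (f x) = a x * deriv f x)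
    (hA3 : ∀ x ∈ U,
      deriv (deriv (deriv a)) x + ν x * deriv a x + (deriv ν x / 2) * a x = 0) :
    ∀ x ∈ U,
      ν (f x) * (deriv f x) ^ 2 + 2 * deriv (deriv (deriv f)) x / deriv f x
        - 3 * (deriv (deriv f) x / deriv f x) ^ 2 = ν x := by
  have hasDeriv {g : ℂ → ℂ} (hg : DifferentiableOn ℂ g U) {z : ℂ} (hz : z ∈ U) :
      HasDerivAt g (deriv g z) z := (hg.differentiableAt (hUopen.mem_nhds hz)).hasDerivAt
  have ha₁ := ha.deriv hUopen
  have hf₁ := hf.deriv hUopen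
  have hf₂ := hf₁.deriv hUopen
  have hinv₁ : ∀ z ∈ U, deriv a (f z) * deriv f z =
      deriv a z * deriv f z + a z * deriv (deriv f) z := by
    intro z hz
    have hl := (hasDeriv ha (hfmaps hz)).comp z (hasDeriv hf hz)
    have hr := (hasDeriv ha hz).mul (hasDeriv hf₁ hz)
    exact hl.unique (hr.congr_of_eventuallyEq
      (Filter.eventually_of_mem (hUopen.mem_nhds hz) hinv))
  intro x hx
  have hinv₂ : deriv (deriv a) (f x) * deriv f x * deriv f x + deriv a (f x) * deriv (deriv f) x =
      deriv (deriv a) x * deriv f x + deriv a x * deriv (deriv f) x +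
        (deriv a x * deriv (deriv f) x + a x * deriv (deriv (deriv f)) x) := by
    have hl := ((hasDeriv ha₁ (hfmaps hx)).comp x (hasDeriv hf hx)).mul (hasDeriv hf₁ hx)
    have hr := ((hasDeriv ha₁ hx).mul (hasDeriv hf₁ hx)).add
      ((hasDeriv ha hx).mul (hasDeriv hf₂ hx))
    exact hl.unique (hr.congr_of_eventuallyEq
      (Filter.eventually_of_mem (hUopen.mem_nhds hx) hinv₁))
  have hconst := first_integral_eq_of_A3 hUopen hUconn.isPreconnected ha hν hA3 (hfmaps hx) hx
  have hp := hf0 x hx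
  have hA := ha0 x hx
  have h₁ : deriv a (f x) = deriv a x + a x * (deriv (deriv f) x / deriv f x) := by
    field_simp
    linear_combination hinv₁ x hx
  have h₂ : deriv f x * deriv (deriv a) (f x) = deriv (deriv a) x +
      deriv a x * (deriv (deriv f) x / deriv f x) +
      a x * (deriv (deriv (deriv f)) x / deriv f x - (deriv (deriv f) x / deriv f x) ^ 2) := by
    rw [h₁] at hinv₂
    field_simp at hinv₂ ⊢
    linear_combination hinv₂
  rw [hinv x hx, h₁] at hconst
  refine mul_left_cancel₀ (pow_ne_zero 2 hA) ?_
  rw [mul_div_assoc]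
  linear_combination hconst - 2 * a x * h₂
end

section
/- Let U ⊆ ℂⁿ be open and let wᵢ, aᵢ : U → ℂ (1 ≤ i ≤ n) be holomorphic functions satisfying dω = ω ∧ α, i.e. ∂ᵢwⱼ − ∂ⱼwᵢ = wᵢaⱼ − wⱼaᵢ on U for all i, j. Let Γ : U → U be holomorphic and let f : U → ℂ be a nowhere-vanishing holomorphic function with Γ*ω = f·ω, i.e. Σⱼ (wⱼ∘Γ)·∂ᵢΓⱼ = f·wᵢ for all i. Then the 1-form Γ*α − α + df/f is proportional to ω: for all i, j and all x ∈ U, ((Γ*α)ᵢ(x) − aᵢ(x) + ∂ᵢf(x)/f(x))·wⱼ(x) = ((Γ*α)ⱼ(x) − aⱼ(x) + ∂ⱼf(x)/f(x))·wᵢ(x). -/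
open scoped BigOperators

/-- The `i`-th complex partial derivative of `f : ℂⁿ → ℂ` at `x`. -/
noncomputable def pd {n : ℕ} (i : Fin n) (f : (Fin n → ℂ) → ℂ) (x : Fin n → ℂ) : ℂ :=
  fderiv ℂ f x (Pi.single i 1)

/-- The `i`-th component of the pullback `Γ*η` of the 1-form `η = Σⱼ hⱼ dxⱼ`
under `Γ : ℂⁿ → ℂⁿ`: `(Γ*η)ᵢ = Σⱼ (hⱼ ∘ Γ) · ∂ᵢΓⱼ`. -/
noncomputable def pullback1 {n : ℕ} (Γ : (Fin n → ℂ) → (Fin n → ℂ))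
    (h : Fin n → (Fin n → ℂ) → ℂ) (i : Fin n) (x : Fin n → ℂ) : ℂ :=
  ∑ j, h j (Γ x) * pd i (fun y => Γ y j) x

open Metric MeasureTheory Filter Topology

/-- A function holomorphic near a point has locally bounded derivative there. -/
lemma exists_ball_norm_fderiv_le {E : Type*} [NormedAddCommGroup E] [NormedSpace ℂ E]
    {f : E → ℂ} {U : Set E} (hU : IsOpen U) (hf : DifferentiableOn ℂ f U) {x : E} (hx : x ∈ U) :
    ∃ ε > 0, ∃ C : ℝ, ball x ε ⊆ U ∧ ∀ y ∈ ball x ε, ‖fderiv ℂ f y‖ ≤ C := by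
  have hcont : ContinuousAt f x := (hf.continuousOn).continuousAt (hU.mem_nhds hx)
  obtain ⟨ε, hε, hball⟩ := Metric.mem_nhds_iff.1
    (inter_mem (hU.mem_nhds hx) (hcont (ball_mem_nhds (f x) one_pos)))
  have hsub : ∀ y ∈ ball x (ε / 2), ball y (ε / 2) ⊆ ball x ε := fun y hy =>
    ball_subset_ball' (by linarith [mem_ball.1 hy])
  refine ⟨ε / 2, by positivity, 2 / (ε / 2), fun y hy => (hball (hsub y hy
    (mem_ball_self (by positivity)))).1, fun y hy => ?_⟩
  refine Complex.norm_fderiv_le_div_of_mapsTo_ball (hf.mono fun z hz => (hball (hsub y hy hz)).1)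
    (fun z hz => ?_) (by positivity)
  have h₁ : dist (f z) (f x) < 1 := (hball (hsub y hy hz)).2
  have h₂ : dist (f y) (f x) < 1 := (hball (hsub y hy (mem_ball_self (by positivity)))).2
  rw [mem_closedBall]
  linarith [dist_triangle_right (f z) (f y) (f x)]

/-- Cauchy's formula for a directional derivative of a holomorphic function. -/
lemma fderiv_apply_eq_circleIntegral {E : Type*} [NormedAddCommGroup E] [NormedSpace ℂ E]
    {f : E → ℂ} {x v : E} {R : ℝ} (hR : 0 < R)
    (hf : ∀ z ∈ closedBall (0 : ℂ) R, DifferentiableAt ℂ f (x + z • v)) :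
    fderiv ℂ f x v =
      (2 * Real.pi * Complex.I)⁻¹ • ∮ z in C(0, R), (1 / (z - 0) ^ 2) • f (x + z • v) := by
  have hline : ∀ z : ℂ, HasDerivAt (fun z : ℂ => x + z • v) v z := fun z => by
    simpa using ((hasDerivAt_id z).smul_const v).const_add x
  have hd : DifferentiableOn ℂ (fun z : ℂ => f (x + z • v)) (closedBall 0 R) := fun z hz =>
    ((hf z hz).hasFDerivAt.comp_hasDerivAt z (hline z)).differentiableAt.differentiableWithinAt
  have h0 : HasDerivAt (fun z : ℂ => f (x + z • v)) (fderiv ℂ f x v) 0 := by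
    have := (hf 0 (mem_closedBall_self hR.le)).hasFDerivAt.comp_hasDerivAt 0 (hline 0)
    simpa [Function.comp_def] using this
  rw [hd.deriv_eq_smul_circleIntegral hR, h0.deriv, inv_smul_smul₀ Complex.two_pi_I_ne_zero]

/-- Directional derivatives of holomorphic functions on `ℂⁿ` are holomorphic. -/
lemma differentiableOn_fderiv_apply {n : ℕ} {f : (Fin n → ℂ) → ℂ}
    {U : Set (Fin n → ℂ)} (hU : IsOpen U) (hf : DifferentiableOn ℂ f U) (v : Fin n → ℂ) :
    DifferentiableOn ℂ (fun x => fderiv ℂ f x v) U := by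
  intro x₀ hx₀
  obtain ⟨ε, hε, C, hball, hC⟩ := exists_ball_norm_fderiv_le hU hf hx₀
  obtain ⟨R, hR, hRv⟩ : ∃ R > 0, R * ‖v‖ < ε / 2 := by
    refine ⟨ε / 2 / (‖v‖ + 1), by positivity, ?_⟩
    rw [div_mul_eq_mul_div, div_lt_iff₀ (by positivity)]
    nlinarith [norm_nonneg v]
  have hmem : ∀ x ∈ ball x₀ (ε / 2), ∀ z ∈ closedBall (0 : ℂ) R, x + z • v ∈ ball x₀ ε := by
    intro x hx z hz
    rw [mem_ball_iff_norm] at hx ⊢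
    have hz' : ‖z • v‖ ≤ R * ‖v‖ := by
      rw [norm_smul]
      exact mul_le_mul_of_nonneg_right (by simpa using hz) (norm_nonneg v)
    calc ‖x + z • v - x₀‖ = ‖(x - x₀) + z • v‖ := by congr 1; abel
      _ ≤ ‖x - x₀‖ + ‖z • v‖ := norm_add_le _ _
      _ < ε := by linarith
  have hdiff : ∀ y ∈ ball x₀ ε, DifferentiableAt ℂ f y := fun y hy =>
    hf.differentiableAt (hU.mem_nhds (hball hy))
  have hnhds : ball x₀ (ε / 2) ∈ 𝓝 x₀ := ball_mem_nhds _ (by positivity)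
  have hcircle : ∀ θ : ℝ, circleMap 0 R θ ∈ closedBall (0 : ℂ) R :=
    circleMap_mem_closedBall 0 hR.le
  have heq : (fun x => fderiv ℂ f x v) =ᶠ[𝓝 x₀] fun x => (2 * Real.pi * Complex.I)⁻¹ •
      ∮ z in C(0, R), (1 / (z - 0) ^ 2) • f (x + z • v) := by
    filter_upwards [hnhds] with x hx
    exact fderiv_apply_eq_circleIntegral hR fun z hz => hdiff _ (hmem x hx z hz)
  suffices h : DifferentiableAt ℂ
      (fun x => ∮ z in C(0, R), (1 / (z - 0) ^ 2) • f (x + z • v)) x₀ from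
    ((h.fun_const_smul _).congr_of_eventuallyEq heq).differentiableWithinAt
  set k : ℝ → ℂ := fun θ => deriv (circleMap 0 R) θ * (1 / (circleMap 0 R θ - 0) ^ 2) with hk
  have hk_cont : Continuous k := by
    simp only [hk, deriv_circleMap]
    refine ((continuous_circleMap 0 R).mul continuous_const).mul
      (continuous_const.div (((continuous_circleMap 0 R).sub continuous_const).pow 2) fun θ => ?_)
    exact pow_ne_zero 2 (sub_ne_zero.2 (circleMap_ne_center hR.ne'))
  have hk_norm : ∀ θ, ‖k θ‖ ≤ R⁻¹ := fun θ => by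
    simp only [hk, deriv_circleMap]
    refine le_of_eq ?_
    simp only [sub_zero, norm_mul, norm_div, norm_pow, norm_one, Complex.norm_I,
      norm_circleMap_zero, abs_of_pos hR]
    field_simp
  have hF_cont : ∀ x ∈ ball x₀ (ε / 2),
      Continuous fun θ : ℝ => k θ • f (x + circleMap 0 R θ • v) := fun x hx =>
    hk_cont.smul (hf.continuousOn.comp_continuous (by fun_prop)
      fun θ => hball (hmem x hx _ (hcircle θ)))
  have hint : (fun x => ∮ z in C(0, R), (1 / (z - 0) ^ 2) • f (x + z • v)) =
      fun x => ∫ θ in Set.Ioc 0 (2 * Real.pi), k θ • f (x + circleMap 0 R θ • v) := by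
    funext x
    rw [circleIntegral, intervalIntegral.integral_of_le (by positivity)]
    simp only [hk, smul_eq_mul, mul_assoc]
  rw [hint]
  refine (hasFDerivAt_integral_of_dominated_of_fderiv_le (𝕜 := ℂ) (bound := fun _ => R⁻¹ * C)
    (F' := fun x θ => k θ • fderiv ℂ f (x + circleMap 0 R θ • v)) hnhds ?_ ?_ ?_ ?_ ?_
    ?_).differentiableAt
  · filter_upwards [hnhds] with x hx using (hF_cont x hx).aestronglyMeasurable
  · exact ((hF_cont x₀ (mem_of_mem_nhds hnhds)).integrableOn_Icc).mono_set Set.Ioc_subset_Icc_self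
  · have hm : Measurable fun θ : ℝ => fderiv ℂ f (x₀ + circleMap 0 R θ • v) :=
      (measurable_fderiv ℂ f).comp (by fun_prop : Continuous _).measurable
    exact hk_cont.aestronglyMeasurable.smul hm.aestronglyMeasurable
  · refine Eventually.of_forall fun θ x hx => ?_
    rw [norm_smul]
    exact mul_le_mul (hk_norm θ) (hC _ (hmem x hx _ (hcircle θ))) (norm_nonneg _) (by positivity)
  · exact integrableOn_const measure_Ioc_lt_top.ne
  · refine Eventually.of_forall fun θ x hx => ?_
    have h := (hdiff _ (hmem x hx _ (hcircle θ))).hasFDerivAt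
    exact ((hasFDerivAt_comp_add_right _).2 h).const_smul (k θ)

/-- A differential on `ℂⁿ` in terms of partial derivatives. -/
lemma fderiv_apply_eq_sum_pd {n : ℕ} (f : (Fin n → ℂ) → ℂ) (x v : Fin n → ℂ) :
    fderiv ℂ f x v = ∑ l, pd l f x * v l := by
  conv_lhs => rw [← Finset.univ_sum_single v, map_sum]
  refine Finset.sum_congr rfl fun l _ => ?_
  have hv : (Pi.single l (v l) : Fin n → ℂ) = v l • Pi.single l 1 := by
    rw [← Pi.single_smul, smul_eq_mul, mul_one]
  rw [hv, map_smul, smul_eq_mul, mul_comm, pd]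

/-- Mixed partial derivatives of a holomorphic function on `ℂⁿ` commute. -/
lemma pd_pd_comm {n : ℕ} {f : (Fin n → ℂ) → ℂ} {U : Set (Fin n → ℂ)} (hU : IsOpen U)
    (hf : DifferentiableOn ℂ f U) {x : Fin n → ℂ} (hx : x ∈ U) (i j : Fin n) :
    pd i (pd j f) x = pd j (pd i f) x := by
  have hsum : fderiv ℂ f = fun y => ∑ l, fderiv ℂ f y (Pi.single l 1) •
      (ContinuousLinearMap.proj l : (Fin n → ℂ) →L[ℂ] ℂ) := by
    funext y
    ext v
    simp [fderiv_apply_eq_sum_pd f y v, pd]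
  have h : DifferentiableAt ℂ (fderiv ℂ f) x := by
    rw [hsum]
    exact DifferentiableAt.fun_sum fun l _ =>
      ((differentiableOn_fderiv_apply hU hf _).differentiableAt (hU.mem_nhds hx)).smul_const _
  have hpd : ∀ a b : Fin n, pd a (pd b f) x =
      fderiv ℂ (fderiv ℂ f) x (Pi.single a 1) (Pi.single b 1) := fun a b => by
    change fderiv ℂ (fun y => fderiv ℂ f y (Pi.single b 1)) x (Pi.single a 1) = _
    rw [fderiv_clm_apply h (differentiableAt_const _)]
    simp
  rw [hpd, hpd]
  refine second_derivative_symmetric_of_eventually (f := f) ?_ h.hasFDerivAt _ _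
  filter_upwards [hU.mem_nhds hx] with y hy
  exact (hf.differentiableAt (hU.mem_nhds hy)).hasFDerivAt

/-- The product rule for partial derivatives. -/
lemma pd_mul {n : ℕ} {f g : (Fin n → ℂ) → ℂ} {x : Fin n → ℂ} (hf : DifferentiableAt ℂ f x)
    (hg : DifferentiableAt ℂ g x) (i : Fin n) :
    pd i (fun y => f y * g y) x = pd i f x * g x + f x * pd i g x := by
  simp only [pd, fderiv_fun_mul hf hg, add_apply, smul_apply,
    smul_eq_mul]
  ring

/-- The chain rule for partial derivatives. -/
lemma pd_comp {n : ℕ} {h : (Fin n → ℂ) → ℂ} {Γ : (Fin n → ℂ) → (Fin n → ℂ)} {x : Fin n → ℂ}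
    (hh : DifferentiableAt ℂ h (Γ x)) (hΓ : DifferentiableAt ℂ Γ x) (i : Fin n) :
    pd i (fun y => h (Γ y)) x = ∑ l, pd l h (Γ x) * pd i (fun y => Γ y l) x := by
  have hΓl : ∀ l, pd i (fun y => Γ y l) x = fderiv ℂ Γ x (Pi.single i 1) l := fun l => by
    rw [pd, fderiv_apply hΓ]
    rfl
  simp only [hΓl]
  rw [pd, fderiv_fun_comp x hh hΓ, ContinuousLinearMap.comp_apply]
  exact fderiv_apply_eq_sum_pd _ _ _

/-- The partial derivatives of the components of a pulled back 1-form. -/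
lemma pd_pullback1 {n : ℕ} {U : Set (Fin n → ℂ)} (hU : IsOpen U)
    {w : Fin n → (Fin n → ℂ) → ℂ} (hw : ∀ i, DifferentiableOn ℂ (w i) U)
    {Γ : (Fin n → ℂ) → (Fin n → ℂ)} (hΓ : DifferentiableOn ℂ Γ U) (hΓmaps : Set.MapsTo Γ U U)
    {x : Fin n → ℂ} (hx : x ∈ U) (i j : Fin n) :
    pd j (pullback1 Γ w i) x =
      ∑ k, ∑ l, pd l (w k) (Γ x) * pd j (fun y => Γ y l) x * pd i (fun y => Γ y k) x +
        ∑ k, w k (Γ x) * pd j (pd i fun y => Γ y k) x := by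
  have hΓx : DifferentiableAt ℂ Γ x := hΓ.differentiableAt (hU.mem_nhds hx)
  have hwx : ∀ k, DifferentiableAt ℂ (w k) (Γ x) := fun k =>
    (hw k).differentiableAt (hU.mem_nhds (hΓmaps hx))
  have hwΓ : ∀ k, DifferentiableAt ℂ (fun y => w k (Γ y)) x := fun k => (hwx k).comp x hΓx
  have hpd : ∀ k, DifferentiableAt ℂ (pd i fun y => Γ y k) x := fun k =>
    (differentiableOn_fderiv_apply hU (differentiableOn_pi.1 hΓ k) _).differentiableAt (hU.mem_nhds hx)
  have hsum : pd j (pullback1 Γ w i) x =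
      ∑ k, pd j (fun y => w k (Γ y) * pd i (fun y => Γ y k) y) x := by
    change fderiv ℂ (fun y => ∑ k, w k (Γ y) * pd i (fun y => Γ y k) y) x _ = _
    rw [fderiv_fun_sum fun k _ => (hwΓ k).fun_mul (hpd k), sum_apply]
    rfl
  rw [hsum, ← Finset.sum_add_distrib]
  refine Finset.sum_congr rfl fun k _ => ?_
  rw [pd_mul (hwΓ k) (hpd k), pd_comp (hwx k) hΓx, Finset.sum_mul]

/-- If `dω = ω ∧ α`, then `d(Γ*ω) = Γ*ω ∧ Γ*α`. -/
lemma pd_pullback1_sub_pd_pullback1 {n : ℕ} {U : Set (Fin n → ℂ)} (hU : IsOpen U)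
    {w α : Fin n → (Fin n → ℂ) → ℂ} (hw : ∀ i, DifferentiableOn ℂ (w i) U)
    (hGV : ∀ i j, ∀ x ∈ U,
      pd i (w j) x - pd j (w i) x = w i x * α j x - w j x * α i x)
    {Γ : (Fin n → ℂ) → (Fin n → ℂ)} (hΓ : DifferentiableOn ℂ Γ U) (hΓmaps : Set.MapsTo Γ U U)
    {x : Fin n → ℂ} (hx : x ∈ U) (i j : Fin n) :
    pd i (pullback1 Γ w j) x - pd j (pullback1 Γ w i) x =
      pullback1 Γ w i x * pullback1 Γ α j x - pullback1 Γ w j x * pullback1 Γ α i x := by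
  have hsymm : ∀ k, pd j (pd i fun y => Γ y k) x = pd i (pd j fun y => Γ y k) x := fun k =>
    pd_pd_comm hU (differentiableOn_pi.1 hΓ k) hx j i
  rw [pd_pullback1 hU hw hΓ hΓmaps hx, pd_pullback1 hU hw hΓ hΓmaps hx]
  simp only [hsymm, add_sub_add_right_eq_sub]
  rw [Finset.sum_comm (f := fun k l =>
    pd l (w k) (Γ x) * pd j (fun y => Γ y l) x * pd i (fun y => Γ y k) x)]
  simp only [pullback1, Finset.sum_mul_sum]
  rw [Finset.sum_comm (f := fun k l =>
    w k (Γ x) * pd i (fun y => Γ y k) x * (α l (Γ x) * pd j (fun y => Γ y l) x))]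
  simp only [← Finset.sum_sub_distrib]
  refine Finset.sum_congr rfl fun k _ => Finset.sum_congr rfl fun l _ => ?_
  linear_combination (pd i (fun y => Γ y l) x * pd j (fun y => Γ y k) x) *
    hGV l k (Γ x) (hΓmaps hx)

/-- If `dω = ω ∧ α` and `Γ*ω = f·ω` with `f` nowhere vanishing, then
the 1-form `Γ*α − α + df/f` is proportional to `ω`. -/
theorem pullback_alpha_proportional_omega {n : ℕ}
    (U : Set (Fin n → ℂ)) (hU : IsOpen U)
    (w α : Fin n → (Fin n → ℂ) → ℂ)
    (hw : ∀ i, DifferentiableOn ℂ (w i) U)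
    (hα : ∀ i, DifferentiableOn ℂ (α i) U)
    (hGV : ∀ i j, ∀ x ∈ U,
      pd i (w j) x - pd j (w i) x = w i x * α j x - w j x * α i x)
    (Γ : (Fin n → ℂ) → (Fin n → ℂ))
    (hΓ : DifferentiableOn ℂ Γ U) (hΓmaps : Set.MapsTo Γ U U)
    (f : (Fin n → ℂ) → ℂ)
    (hf : DifferentiableOn ℂ f U) (hf0 : ∀ x ∈ U, f x ≠ 0)
    (hpull : ∀ i, ∀ x ∈ U, pullback1 Γ w i x = f x * w i x) :
    ∀ i j, ∀ x ∈ U,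
      (pullback1 Γ α i x - α i x + pd i f x / f x) * w j x =
      (pullback1 Γ α j x - α j x + pd j f x / f x) * w i x := by
  intro i j x hx
  have hfx : DifferentiableAt ℂ f x := hf.differentiableAt (hU.mem_nhds hx)
  have hpd : ∀ a b, pd a (pullback1 Γ w b) x = pd a f x * w b x + f x * pd a (w b) x := by
    intro a b
    rw [← pd_mul hfx ((hw b).differentiableAt (hU.mem_nhds hx))]
    have heq : pullback1 Γ w b =ᶠ[𝓝 x] fun y => f y * w b y := by
      filter_upwards [hU.mem_nhds hx] with y hy using hpull b y hy
    rw [pd, heq.fderiv_eq]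
    rfl
  have hd := pd_pullback1_sub_pd_pullback1 hU hw hGV hΓ hΓmaps hx i j
  rw [hpd, hpd, hpull i x hx, hpull j x hx] at hd
  have hf0x := hf0 x hx
  field_simp
  linear_combination hd - f x * hGV i j x hx
end

section
/- Let U ⊆ ℂⁿ be open, let wᵢ, aᵢ : U → ℂ be holomorphic, and let H, F, G : U → ℂ be holomorphic with F nowhere vanishing, satisfying for all i: ∂ᵢH = F·wᵢ and ∂ᵢF/F = aᵢ + G·wᵢ. Let a, b, c, e ∈ ℂ be constants with a·e − b·c = 1 such that c·H + e is nowhere vanishing on U, and set H̃ = (a·H + b)/(c·H + e), F̃ = F/(c·H + e)², G̃ = G − 2·c·F/(c·H + e). Then for all i: ∂ᵢH̃ = F̃·wᵢ, ∂ᵢF̃/F̃ = aᵢ + G̃·wᵢ, and ∂ᵢG̃ − G̃·aᵢ − ½·G̃²·wᵢ = ∂ᵢG − G·aᵢ − ½·G²·wᵢ. In particular the 1-form β with components bᵢ = ∂ᵢG − G·aᵢ − ½·G²·wᵢ is unchanged when the first integral H is replaced by the Möbius transform H̃. -/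
open scoped BigOperators

section PartialDerivative

variable {n : ℕ} {i : Fin n} {f g : (Fin n → ℂ) → ℂ} {x : Fin n → ℂ}

lemma pd_sub (hf : DifferentiableAt ℂ f x) (hg : DifferentiableAt ℂ g x) :
    pd i (fun y => f y - g y) x = pd i f x - pd i g x := by
  simp [pd, fderiv_fun_sub hf hg]

lemma pd_const_mul (c : ℂ) (hf : DifferentiableAt ℂ f x) :
    pd i (fun y => c * f y) x = c * pd i f x := by
  simp [pd, fderiv_const_mul hf]

lemma pd_const_mul_add_const (c d : ℂ) (hf : DifferentiableAt ℂ f x) :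
    pd i (fun y => c * f y + d) x = c * pd i f x := by
  simp [pd, fderiv_add_const, fderiv_const_mul hf]

lemma pd_sq (hf : DifferentiableAt ℂ f x) :
    pd i (fun y => f y ^ 2) x = 2 * f x * pd i f x := by
  simp [pd, fderiv_fun_pow 2 hf]

lemma hasFDerivAt_div (hf : DifferentiableAt ℂ f x) (hg : DifferentiableAt ℂ g x)
    (hgx : g x ≠ 0) :
    HasFDerivAt (fun y => f y / g y)
      (f x • (-(g x ^ 2)⁻¹ • fderiv ℂ g x) + (g x)⁻¹ • fderiv ℂ f x) x := by
  simpa only [div_eq_mul_inv, Function.comp_def] using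
    hf.hasFDerivAt.fun_mul ((hasDerivAt_inv hgx).comp_hasFDerivAt x hg.hasFDerivAt)

lemma pd_div (hf : DifferentiableAt ℂ f x) (hg : DifferentiableAt ℂ g x) (hgx : g x ≠ 0) :
    pd i (fun y => f y / g y) x = (pd i f x * g x - f x * pd i g x) / g x ^ 2 := by
  simp only [pd, (hasFDerivAt_div hf hg hgx).fderiv, add_apply, smul_apply, smul_eq_mul]
  field_simp
  ring

end PartialDerivative

/-- Well-definedness of the third Godbillon-Vey form `β = dG − G·α − ½G²·ω`
under the projective change of determination `H ↦ (aH+b)/(cH+e)` (with `ae − bc = 1`):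
setting `H̃ = (aH+b)/(cH+e)`, `F̃ = F/(cH+e)²`, `G̃ = G − 2cF/(cH+e)`, one still has
`dH̃ = F̃·ω`, `dF̃/F̃ = α + G̃·ω`, and `dG̃ − G̃·α − ½G̃²·ω = dG − G·α − ½G²·ω`. -/
theorem beta_well_defined {n : ℕ}
    (U : Set (Fin n → ℂ)) (hU : IsOpen U)
    (w α : Fin n → (Fin n → ℂ) → ℂ)
    (hw : ∀ i, DifferentiableOn ℂ (w i) U)
    (hα : ∀ i, DifferentiableOn ℂ (α i) U)
    (H F G : (Fin n → ℂ) → ℂ)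
    (hH : DifferentiableOn ℂ H U) (hF : DifferentiableOn ℂ F U)
    (hG : DifferentiableOn ℂ G U)
    (hF0 : ∀ x ∈ U, F x ≠ 0)
    (hdH : ∀ i, ∀ x ∈ U, pd i H x = F x * w i x)
    (hdF : ∀ i, ∀ x ∈ U, pd i F x / F x = α i x + G x * w i x)
    (a b c e : ℂ) (hdet : a * e - b * c = 1)
    (hden : ∀ x ∈ U, c * H x + e ≠ 0) :
    (∀ i, ∀ x ∈ U,
      pd i (fun y => (a * H y + b) / (c * H y + e)) x
        = (F x / (c * H x + e) ^ 2) * w i x) ∧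
    (∀ i, ∀ x ∈ U,
      pd i (fun y => F y / (c * H y + e) ^ 2) x / (F x / (c * H x + e) ^ 2)
        = α i x + (G x - 2 * c * F x / (c * H x + e)) * w i x) ∧
    (∀ i, ∀ x ∈ U,
      pd i (fun y => G y - 2 * c * F y / (c * H y + e)) x
          - (G x - 2 * c * F x / (c * H x + e)) * α i x
          - (1 / 2) * (G x - 2 * c * F x / (c * H x + e)) ^ 2 * w i x
        = pd i G x - G x * α i x - (1 / 2) * G x ^ 2 * w i x) := by
  have diffAt {f : (Fin n → ℂ) → ℂ} (hf : DifferentiableOn ℂ f U) {x} (hx : x ∈ U) :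
      DifferentiableAt ℂ f x := hf.differentiableAt (hU.mem_nhds hx)
  have pdF (i) {x} (hx : x ∈ U) : pd i F x = (α i x + G x * w i x) * F x :=
    (div_eq_iff (hF0 x hx)).1 (hdF i x hx)
  have diffDen {x} (hx : x ∈ U) : DifferentiableAt ℂ (fun y => c * H y + e) x :=
    ((diffAt hH hx).const_mul c).add_const e
  refine ⟨fun i x hx => ?_, fun i x hx => ?_, fun i x hx => ?_⟩ <;>
    have hD := hden x hx
  · rw [pd_div (((diffAt hH hx).const_mul a).add_const b) (diffDen hx) hD,
      pd_const_mul_add_const a b (diffAt hH hx), pd_const_mul_add_const c e (diffAt hH hx),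
      hdH i x hx, div_mul_eq_mul_div]
    congr 1
    linear_combination F x * w i x * hdet
  · have hFx := hF0 x hx
    rw [pd_div (diffAt hF hx) ((diffDen hx).fun_pow 2) (pow_ne_zero 2 hD), pd_sq (diffDen hx),
      pd_const_mul_add_const c e (diffAt hH hx), hdH i x hx, pdF i hx]
    field_simp
    ring
  · have hcF : DifferentiableAt ℂ (fun y => 2 * c * F y) x := (diffAt hF hx).const_mul (2 * c)
    rw [pd_sub (diffAt hG hx) (hasFDerivAt_div hcF (diffDen hx) hD).differentiableAt, pd_div hcF (diffDen hx) hD,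
      pd_const_mul (2 * c) (diffAt hF hx), pd_const_mul_add_const c e (diffAt hH hx),
      hdH i x hx, pdF i hx]
    field_simp
    ring
end

section
/- Let K be a Δ-field and ω = (w₁, w₂) ∈ K² with (w₁, w₂) ≠ (0, 0). The following are equivalent. (a) There exist a Δ-field extension E of K, a Darboux tower K = K₀ ⊆ K₁ ⊆ … ⊆ K_m = E of differential subfields, and an element H ∈ E with δ₁H·w₂ − δ₂H·w₁ = 0 and (δ₁H, δ₂H) ≠ (0, 0). (b) There exist F ∈ K with F ≠ 0 and a positive integer p such that δ₁F·w₂ − δ₂F·w₁ + p·F·(δ₁w₂ − δ₂w₁) = 0 (i.e. a p-th root of F is an integrating factor for ω: d(F^{1/p}·ω) = 0, a Godbillon–Vey sequence of length one). -/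
open scoped BigOperators

/-- A Δ-field: a field of characteristic zero equipped with two commuting
derivations `d₁`, `d₂`. -/
structure DeltaField where
  carrier : Type
  [field : Field carrier]
  [charZero : CharZero carrier]
  d₁ : carrier → carrier
  d₂ : carrier → carrier
  d₁_add : ∀ x y, d₁ (x + y) = d₁ x + d₁ y
  d₁_mul : ∀ x y, d₁ (x * y) = d₁ x * y + x * d₁ y
  d₂_add : ∀ x y, d₂ (x + y) = d₂ x + d₂ y
  d₂_mul : ∀ x y, d₂ (x * y) = d₂ x * y + x * d₂ y
  comm : ∀ x, d₁ (d₂ x) = d₂ (d₁ x)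

attribute [instance] DeltaField.field DeltaField.charZero

/-- A differential subfield: a subfield closed under both derivations. -/
def DiffSubfield (E : DeltaField) (L : Subfield E.carrier) : Prop :=
  ∀ x ∈ L, E.d₁ x ∈ L ∧ E.d₂ x ∈ L

/-- `x` is algebraic over the subfield `L`: it satisfies a nonzero polynomial
relation with coefficients in `L`. -/
def AlgebraicOver (E : DeltaField) (L : Subfield E.carrier) (x : E.carrier) : Prop :=
  ∃ (k : ℕ) (c : Fin (k + 1) → E.carrier),
    (∀ j, c j ∈ L) ∧ (∃ j, c j ≠ 0) ∧ ∑ j, c j * x ^ (j : ℕ) = 0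

/-- An algebraic extension step `L ⊆ M`. -/
def AlgStep (E : DeltaField) (L M : Subfield E.carrier) : Prop :=
  ∀ x ∈ M, AlgebraicOver E L x

/-- A Darboux extension step: `M = L(G)` with `d₁G ∈ L` and `d₂G ∈ L`
(i.e. `dG = γ` with `γ` a form with coefficients in `L`). -/
def DarbouxStep (E : DeltaField) (L M : Subfield E.carrier) : Prop :=
  ∃ G : E.carrier, E.d₁ G ∈ L ∧ E.d₂ G ∈ L ∧
    M = Subfield.closure ((L : Set E.carrier) ∪ {G})

/-- A Darboux tower over `K₀` inside `E`: a chain of differential subfields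
`K₀ = Ks 0 ⊆ … ⊆ Ks m = E` in which each step is either algebraic or Darboux. -/
def DarbouxTower (E : DeltaField) (K₀ : Subfield E.carrier) : Prop :=
  ∃ (m : ℕ) (Ks : Fin (m + 1) → Subfield E.carrier),
    Ks 0 = K₀ ∧ Ks (Fin.last m) = ⊤ ∧
    (∀ i, DiffSubfield E (Ks i)) ∧
    (∀ i : Fin m, Ks i.castSucc ≤ Ks i.succ ∧
      (AlgStep E (Ks i.castSucc) (Ks i.succ) ∨ DarbouxStep E (Ks i.castSucc) (Ks i.succ)))

section Descent

open Polynomial Differential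
open scoped Differential

variable {L E : Type*} [Field L] [Field E] [Differential L] [Differential E]
  [Algebra L E] [DifferentialAlgebra L E]

/-- An algebraic exponential over a differential field `L` has a power which, up to a constant,
lies in `L`: the constant coefficient of its minimal polynomial. -/
theorem exists_exponential_of_isAlgebraic {x : E} (hx : x ≠ 0) (halg : IsAlgebraic L x) {c : L}
    (hc : x′ = algebraMap L E c * x) :
    ∃ y : L, y ≠ 0 ∧ ∃ n : ℕ, 0 < n ∧ y′ = n * c * y := by
  set P := minpoly L x with hP
  have hint : IsIntegral L x := halg.isIntegral
  have hmonic : P.Monic := minpoly.monic hint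
  set Q : L[X] := mapCoeffs P + C c * X * derivative P - C (P.natDegree * c) * P with hQ
  have hQx : aeval x Q = 0 := by
    have h := deriv_aeval_eq (A := L) x P
    rw [hP, minpoly.aeval, ← hP, map_zero, hc] at h
    have h0 : aeval x P = 0 := minpoly.aeval L x
    simp only [hQ, map_sub, map_add, map_mul, aeval_C, aeval_X, h0, mul_zero, sub_zero]
    rw [h]; ring
  have hcoeff (i : ℕ) :
      Q.coeff i = (P.coeff i)′ + i * c * P.coeff i - P.natDegree * c * P.coeff i := by
    cases i with
    | zero => simp [hQ, mul_assoc]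
    | succ i =>
      simp only [hQ, coeff_sub, coeff_add, coeff_mapCoeffs, coeff_C_mul, mul_assoc (C c),
        coeff_X_mul, coeff_derivative]
      push_cast; ring
  have hQ0 : Q = 0 := by
    by_contra hne
    have hdeg : P.degree ≤ Q.degree := minpoly.degree_le_of_ne_zero L x hne hQx
    refine absurd hdeg (not_le.mpr ?_)
    rw [degree_eq_natDegree hmonic.ne_zero, degree_lt_iff_coeff_zero]
    intro m hm
    rw [hcoeff]
    rcases hm.eq_or_lt with rfl | hlt
    · simp [hmonic.coeff_natDegree]
    · simp [coeff_eq_zero_of_natDegree_lt hlt]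
  refine ⟨P.coeff 0, minpoly.coeff_zero_ne_zero hint hx, P.natDegree,
    minpoly.natDegree_pos hint, ?_⟩
  have h := hcoeff 0
  rw [hQ0] at h
  simp only [coeff_zero, Nat.cast_zero, zero_mul, add_zero] at h
  exact (sub_eq_zero.mp h.symm)

/-- An exponential in a primitive transcendental extension `L(G)` gives one in `L`:
the quotient of the leading coefficients of numerator and denominator. -/
theorem exists_exponential_of_transcendental {G : E} (hG : Transcendental L G) {g : L}
    (hg : G′ = algebraMap L E g) {A B : L[X]} (hA : A ≠ 0) (hB : B ≠ 0) {c : L}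
    (hc : (aeval G A / aeval G B)′ = algebraMap L E c * (aeval G A / aeval G B)) :
    ∃ y : L, y ≠ 0 ∧ y′ = c * y := by
  have hinj : Function.Injective (aeval G : L[X] →ₐ[L] E) :=
    transcendental_iff_injective.mp hG
  have hBG : aeval G B ≠ 0 := fun h ↦ hB (hinj (by simpa using h))
  have hderiv (p : L[X]) : (aeval G p)′ = aeval G (implicitDeriv (C g) p) :=
    deriv_aeval_eq_implicitDeriv G (C g) (by simpa using hg) p
  have hcoeff (p : L[X]) : (implicitDeriv (C g) p).coeff p.natDegree = p.leadingCoeff′ := by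
    have : (derivative p).coeff p.natDegree = 0 := by
      rw [coeff_derivative, coeff_eq_zero_of_natDegree_lt (Nat.lt_succ_self _), zero_mul]
    simp [implicitDeriv, this]
  have hnat (p : L[X]) : (implicitDeriv (C g) p).natDegree ≤ p.natDegree := by
    refine natDegree_le_iff_coeff_eq_zero.mpr fun N hN ↦ ?_
    simp [implicitDeriv, coeff_derivative, coeff_eq_zero_of_natDegree_lt hN,
      coeff_eq_zero_of_natDegree_lt (hN.trans (Nat.lt_succ_self _))]
  have key : implicitDeriv (C g) A * B - A * implicitDeriv (C g) B = C c * (A * B) := by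
    apply hinj
    rw [Derivation.leibniz_div, hderiv, hderiv] at hc
    simp only [map_sub, map_mul, aeval_C]
    simp only [smul_eq_mul] at hc
    field_simp at hc
    linear_combination hc
  have hlead := congrArg (fun p ↦ p.coeff (A.natDegree + B.natDegree)) key
  simp only [coeff_sub, coeff_C_mul] at hlead
  rw [coeff_mul_add_eq_of_natDegree_le (hnat A) le_rfl,
    coeff_mul_add_eq_of_natDegree_le le_rfl (hnat B),
    coeff_mul_add_eq_of_natDegree_le le_rfl le_rfl, hcoeff, hcoeff] at hlead
  have ha : A.leadingCoeff ≠ 0 := leadingCoeff_ne_zero.mpr hA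
  have hb : B.leadingCoeff ≠ 0 := leadingCoeff_ne_zero.mpr hB
  refine ⟨A.leadingCoeff / B.leadingCoeff, div_ne_zero ha hb, ?_⟩
  rw [Derivation.leibniz_div]
  simp only [smul_eq_mul, coeff_natDegree] at hlead ⊢
  field_simp
  linear_combination hlead

end Descent

section Lift

/-- A derivation extends along a formally étale algebra. -/
theorem Derivation.exists_extension_of_formallyEtale {S T : Type*} [CommRing S] [CommRing T]
    [Algebra S T] [Algebra.FormallyEtale S T] (d : Derivation ℤ S S) :
    ∃ D : Derivation ℤ T T, ∀ s, D (algebraMap S T s) = algebraMap S T (d s) := by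
  let l := ((Algebra.linearMap S T).compDer d).liftKaehlerDifferential
  let e := KaehlerDifferential.tensorKaehlerEquivOfFormallyEtale ℤ S T
  refine ⟨((l.liftBaseChange T).comp e.symm.toLinearMap).compDer (KaehlerDifferential.D ℤ T),
    fun s ↦ ?_⟩
  simp [e, l, KaehlerDifferential.tensorKaehlerEquivOfFormallyEtale_symm_D_algebraMap]

/-- A derivation of a formally unramified algebra which kills the base ring is zero. -/
theorem Derivation.eq_zero_of_formallyUnramified {S T : Type*} [CommRing S] [CommRing T]
    [Algebra S T] [Algebra.FormallyUnramified S T] (D : Derivation ℤ T T)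
    (h : ∀ s, D (algebraMap S T s) = 0) (x : T) : D x = 0 := by
  let D' : Derivation S T T := Derivation.mk'
    { toFun := D
      map_add' := map_add D
      map_smul' := fun s t ↦ by simp [Algebra.smul_def, h] }
    (fun a b ↦ by simp)
  have : D' x = D'.liftKaehlerDifferential (KaehlerDifferential.D S T x) := by simp
  change D' x = 0
  rw [this, Subsingleton.elim (KaehlerDifferential.D S T x) 0, map_zero]

/-- Commuting derivations remain commuting on a formally unramified extension. -/
theorem Derivation.commute_of_formallyUnramified {S T : Type*} [CommRing S] [CommRing T]
    [Algebra S T] [Algebra.FormallyUnramified S T] (D₁ D₂ : Derivation ℤ T T)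
    (h : ∀ s, D₁ (D₂ (algebraMap S T s)) = D₂ (D₁ (algebraMap S T s))) (x : T) :
    D₁ (D₂ x) = D₂ (D₁ x) := by
  have := Derivation.eq_zero_of_formallyUnramified (S := S) ⁅D₁, D₂⁆
    (fun s ↦ by rw [Derivation.commutator_apply, h, sub_self]) x
  rwa [Derivation.commutator_apply, sub_eq_zero] at this

end Lift

section Tower

variable {k : Type*} [Field k] (X : Derivation ℤ k k) (L : Subfield k)

/-- The restriction of a derivation to a subfield it preserves. -/
@[reducible]
def Subfield.differentialOfInvariant (hL : ∀ x ∈ L, X x ∈ L) : Differential L where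
  deriv := Derivation.mk'
    (AddMonoidHom.mk' (fun x : L ↦ (⟨X x, hL x x.2⟩ : L))
      (fun a b ↦ Subtype.ext (by simp))).toIntLinearMap
    (fun a b ↦ Subtype.ext (by simp))

variable {X L}

theorem exists_exponential_mem_of_isAlgebraic (hL : ∀ x ∈ L, X x ∈ L) {x c : k} (hx : x ≠ 0)
    (halg : IsAlgebraic L x) (hcL : c ∈ L) (hc : X x = c * x) :
    ∃ y ∈ L, y ≠ 0 ∧ ∃ n : ℕ, 0 < n ∧ X y = n * c * y := by
  let : Differential L := L.differentialOfInvariant X hL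
  let : Differential k := ⟨X⟩
  have : DifferentialAlgebra L k := ⟨fun _ ↦ rfl⟩
  obtain ⟨y, hy, n, hn, h⟩ := exists_exponential_of_isAlgebraic hx halg (c := ⟨c, hcL⟩) hc
  refine ⟨y, y.2, by simpa using hy, n, hn, ?_⟩
  exact (congrArg Subtype.val h).trans (by simp)

theorem exists_exponential_mem_of_primitive (hL : ∀ x ∈ L, X x ∈ L) {G x c : k} (hG : X G ∈ L)
    (hxM : x ∈ Subfield.closure ((L : Set k) ∪ {G})) (hx : x ≠ 0) (hcL : c ∈ L)
    (hc : X x = c * x) :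
    ∃ y ∈ L, y ≠ 0 ∧ ∃ n : ℕ, 0 < n ∧ X y = n * c * y := by
  have hadj : x ∈ IntermediateField.adjoin L {G} := by
    refine (Subfield.closure_le (t := (IntermediateField.adjoin L {G}).toSubfield)).mpr ?_ hxM
    rintro z (hz | rfl)
    · exact (IntermediateField.adjoin L {G}).algebraMap_mem ⟨z, hz⟩
    · exact IntermediateField.mem_adjoin_simple_self L z
  by_cases hGalg : IsAlgebraic L G
  · have : Algebra.IsAlgebraic L (IntermediateField.adjoin L {G}) :=
      IntermediateField.isAlgebraic_adjoin_simple hGalg.isIntegral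
    have hxalg : IsAlgebraic L x :=
      IntermediateField.isAlgebraic_iff.mp
        (Algebra.IsAlgebraic.isAlgebraic (⟨x, hadj⟩ : IntermediateField.adjoin L {G}))
    exact exists_exponential_mem_of_isAlgebraic hL hx hxalg hcL hc
  · let : Differential L := L.differentialOfInvariant X hL
    let : Differential k := ⟨X⟩
    have : DifferentialAlgebra L k := ⟨fun _ ↦ rfl⟩
    obtain ⟨A, B, rfl⟩ := (IntermediateField.mem_adjoin_simple_iff L x).mp hadj
    have hA : A ≠ 0 := by rintro rfl; simp at hx
    have hB : B ≠ 0 := by rintro rfl; simp at hx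
    obtain ⟨y, hy, h⟩ := exists_exponential_of_transcendental (L := L) (E := k)
      hGalg (g := ⟨X G, hG⟩) rfl hA hB (c := ⟨c, hcL⟩) hc
    exact ⟨y, y.2, by simpa using hy, 1, one_pos,
      (congrArg Subtype.val h).trans (by simp)⟩

end Tower

theorem AlgebraicOver.isAlgebraic {E : DeltaField} {L : Subfield E.carrier} {x : E.carrier}
    (h : AlgebraicOver E L x) : IsAlgebraic L x := by
  obtain ⟨n, c, hcL, ⟨j, hj⟩, hsum⟩ := h
  refine ⟨∑ i : Fin (n + 1), Polynomial.monomial (i : ℕ) (⟨c i, hcL i⟩ : L), fun h0 ↦ hj ?_, ?_⟩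
  · have := congrArg (fun p ↦ p.coeff (j : ℕ)) h0
    simp only [Polynomial.finsetSum_coeff, Polynomial.coeff_monomial, Fin.val_inj,
      Finset.sum_ite_eq', Finset.mem_univ, if_true, Polynomial.coeff_zero] at this
    simpa using congrArg Subtype.val this
  · simp only [map_sum, Polynomial.aeval_monomial]
    exact hsum

theorem algebraicOver_of_isAlgebraic {E : DeltaField} {F : Type*} [Field F]
    [Algebra F E.carrier] {x : E.carrier} (h : IsAlgebraic F x) :
    AlgebraicOver E (algebraMap F E.carrier).fieldRange x := by
  obtain ⟨P, hP, hPx⟩ := h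
  refine ⟨P.natDegree, fun j ↦ algebraMap F E.carrier (P.coeff j), fun j ↦ ⟨_, rfl⟩,
    ⟨Fin.last _, ?_⟩, ?_⟩
  · simpa using hP
  · rw [Polynomial.aeval_eq_sum_range, ← Fin.sum_univ_eq_sum_range
      (fun i ↦ P.coeff i • x ^ i)] at hPx
    simpa [Algebra.smul_def] using hPx

namespace DeltaField

variable (E : DeltaField)

/-- The first derivation of a Δ-field, as a bundled derivation. -/
def der₁ : Derivation ℤ E.carrier E.carrier :=
  Derivation.mk' (AddMonoidHom.mk' E.d₁ E.d₁_add).toIntLinearMap fun a b ↦ by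
    simp [E.d₁_mul]; ring

/-- The second derivation of a Δ-field, as a bundled derivation. -/
def der₂ : Derivation ℤ E.carrier E.carrier :=
  Derivation.mk' (AddMonoidHom.mk' E.d₂ E.d₂_add).toIntLinearMap fun a b ↦ by
    simp [E.d₂_mul]; ring

@[simp] theorem der₁_apply (x : E.carrier) : E.der₁ x = E.d₁ x := rfl

@[simp] theorem der₂_apply (x : E.carrier) : E.der₂ x = E.d₂ x := rfl

end DeltaField

/-- An exponential at the top of a Darboux tower for a derivation `a δ₁ + b δ₂` descends
to the bottom. -/
theorem DarbouxTower.exists_exponential {E : DeltaField} {K₀ : Subfield E.carrier}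
    (hT : DarbouxTower E K₀) {a b c f : E.carrier} (ha : a ∈ K₀) (hb : b ∈ K₀) (hc : c ∈ K₀)
    (hf : f ≠ 0) (h : a * E.d₁ f + b * E.d₂ f = c * f) :
    ∃ F ∈ K₀, F ≠ 0 ∧ ∃ p : ℕ, 0 < p ∧ a * E.d₁ F + b * E.d₂ F = p * c * F := by
  obtain ⟨m, Ks, rfl, htop, hdiff, hstep⟩ := hT
  have hmono : Monotone Ks := Fin.monotone_iff_le_succ.mpr fun i ↦ (hstep i).1
  set X : Derivation ℤ E.carrier E.carrier := a • E.der₁ + b • E.der₂ with hX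
  have hXa (x : E.carrier) : X x = a * E.d₁ x + b * E.d₂ x := by simp [hX]
  have hle (i) : Ks 0 ≤ Ks i := hmono (Fin.zero_le i)
  have hcomb (i) {u v : E.carrier} (hu : u ∈ Ks i) (hv : v ∈ Ks i) : a * u + b * v ∈ Ks i :=
    add_mem (mul_mem (hle i ha) hu) (mul_mem (hle i hb) hv)
  have hinv (i) : ∀ x ∈ Ks i, X x ∈ Ks i := fun x hx ↦ by
    rw [hXa]; exact hcomb i (hdiff i x hx).1 (hdiff i x hx).2
  suffices ∀ i, ∃ F ∈ Ks i, F ≠ 0 ∧ ∃ p : ℕ, 0 < p ∧ X F = p * c * F by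
    simpa only [hXa] using this 0
  intro i
  induction i using Fin.reverseInduction with
  | last => exact ⟨f, htop ▸ Subfield.mem_top f, hf, 1, one_pos, by simp [hXa, h]⟩
  | cast i ih =>
    obtain ⟨F, hF, hF0, p, hp, hXF⟩ := ih
    have hpc : (p : E.carrier) * c ∈ Ks i.castSucc := mul_mem (natCast_mem _ _) (hle _ hc)
    have : ∃ y ∈ Ks i.castSucc, y ≠ 0 ∧ ∃ n : ℕ, 0 < n ∧ X y = n * (p * c) * y := by
      rcases (hstep i).2 with halg | ⟨G, hG₁, hG₂, hM⟩
      · exact exists_exponential_mem_of_isAlgebraic (hinv _) hF0 (halg F hF).isAlgebraic hpc hXF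
      · refine exists_exponential_mem_of_primitive (hinv _) (G := G) ?_ (hM ▸ hF) hF0 hpc hXF
        rw [hXa]; exact hcomb _ hG₁ hG₂
    obtain ⟨y, hy, hy0, n, hn, hXy⟩ := this
    exact ⟨y, hy, hy0, n * p, Nat.mul_pos hn hp, by rw [hXy]; push_cast; ring⟩

/-- A first integral of `ω` yields an integrating factor. -/
theorem exists_integratingFactor_of_firstIntegral {E : DeltaField} {w₁ w₂ H : E.carrier}
    (hw : ¬(w₁ = 0 ∧ w₂ = 0)) (hH : E.d₁ H * w₂ - E.d₂ H * w₁ = 0)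
    (hne : ¬(E.d₁ H = 0 ∧ E.d₂ H = 0)) :
    ∃ f, f ≠ 0 ∧ w₂ * E.d₁ f + -w₁ * E.d₂ f = -(E.d₁ w₂ - E.d₂ w₁) * f := by
  obtain ⟨f, h₁, h₂⟩ : ∃ f, E.d₁ H = f * w₁ ∧ E.d₂ H = f * w₂ := by
    by_cases h : w₁ = 0
    · have h₂ : w₂ ≠ 0 := fun h' ↦ hw ⟨h, h'⟩
      refine ⟨E.d₂ H / w₂, ?_, by field_simp⟩
      subst h
      simpa [h₂] using hH
    · refine ⟨E.d₁ H / w₁, by field_simp, ?_⟩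
      field_simp
      linear_combination -hH
  refine ⟨f, ?_, ?_⟩
  · rintro rfl
    exact hne ⟨by simpa using h₁, by simpa using h₂⟩
  · have h := E.comm H
    rw [h₁, h₂, E.d₁_mul, E.d₂_mul] at h
    linear_combination h

section Extension

open Polynomial

variable {A B : Type*} [Field A] [Field B] [Algebra A B] [Algebra A[X] B]
  [IsScalarTower A A[X] B] [IsFractionRing A[X] B]

/-- Extension of a derivation of `A` to the field `A(G)` of rational functions, with `G`
mapped to a prescribed element of `A`. -/
theorem exists_derivation_fractionRing (d : Derivation ℤ A A) (v : A) :
    ∃ D : Derivation ℤ B B,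
      (∀ a, D (algebraMap A B a) = algebraMap A B (d a)) ∧
      D (algebraMap A[X] B X) = algebraMap A B v := by
  let : Differential A := ⟨d⟩
  have : Algebra.FormallyEtale A[X] B :=
    Algebra.FormallyEtale.of_isLocalization (nonZeroDivisors A[X])
  obtain ⟨D, hD⟩ := Derivation.exists_extension_of_formallyEtale (T := B)
    (Differential.implicitDeriv (C v))
  refine ⟨D, fun a ↦ ?_, ?_⟩
  · rw [IsScalarTower.algebraMap_apply A A[X] B, IsScalarTower.algebraMap_apply A A[X] B]
    exact (hD (C a)).trans (congrArg _ (Differential.implicitDeriv_C (C v) a))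
  · rw [IsScalarTower.algebraMap_apply A A[X] B]
    exact (hD X).trans (congrArg _ (Differential.implicitDeriv_X (C v)))

/-- Derivations of `A(G)` commute as soon as they do on `A` and on `G`. -/
theorem commute_derivation_fractionRing
    (D₁ D₂ : Derivation ℤ B B)
    (hC : ∀ a, D₁ (D₂ (algebraMap A B a)) = D₂ (D₁ (algebraMap A B a)))
    (hX : D₁ (D₂ (algebraMap A[X] B X)) = D₂ (D₁ (algebraMap A[X] B X)))
    (x : B) : D₁ (D₂ x) = D₂ (D₁ x) := by
  have : Algebra.FormallyEtale A[X] B :=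
    Algebra.FormallyEtale.of_isLocalization (nonZeroDivisors A[X])
  refine Derivation.commute_of_formallyUnramified (S := A[X]) D₁ D₂ (fun p ↦ ?_) x
  suffices ⁅D₁, D₂⁆ (algebraMap A[X] B p) = 0 by
    rwa [Derivation.commutator_apply, sub_eq_zero] at this
  have hX' : ⁅D₁, D₂⁆ (algebraMap A[X] B X) = 0 := by
    rw [Derivation.commutator_apply, hX, sub_self]
  have hC' (a : A) : ⁅D₁, D₂⁆ (algebraMap A[X] B (C a)) = 0 := by
    rw [← algebraMap_eq, ← IsScalarTower.algebraMap_apply, Derivation.commutator_apply, hC,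
      sub_self]
  induction p using Polynomial.induction_on' with
  | add p q hp hq => rw [map_add, map_add, hp, hq, add_zero]
  | monomial n a =>
    rw [← C_mul_X_pow_eq_monomial, map_mul, map_pow, Derivation.leibniz, Derivation.leibniz_pow,
      hX', hC']
    simp

variable (A B) in
theorem closure_fractionRing_eq_top :
    Subfield.closure (((algebraMap A B).fieldRange : Set B) ∪
      {algebraMap A[X] B X}) = ⊤ := by
  refine eq_top_iff.mpr fun x _ ↦ ?_
  set M := Subfield.closure (((algebraMap A B).fieldRange :
    Set B) ∪ {algebraMap A[X] B X})
  have hp (p : A[X]) : algebraMap A[X] B p ∈ M := by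
    induction p using Polynomial.induction_on' with
    | add p q hp hq => rw [map_add]; exact add_mem hp hq
    | monomial n a =>
      rw [← C_mul_X_pow_eq_monomial, map_mul, map_pow]
      exact M.mul_mem
        (Subfield.subset_closure (Or.inl ⟨a, IsScalarTower.algebraMap_apply A A[X] B a⟩))
        (M.pow_mem (Subfield.subset_closure (Or.inr rfl)) n)
  obtain ⟨p, q, _, rfl⟩ := IsFractionRing.div_surjective (A := A[X]) x
  exact M.div_mem (hp p) (hp q)

end Extension

/-- Over a Δ-field, a `p`-th root of `F` being an integrating factor for `ω` yields a first
integral in a Darboux tower: adjoin the root and then a primitive of the resulting closed form. -/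
theorem exists_firstIntegral_of_integratingFactor {K : DeltaField} (A B : Type) [Field A]
    [Algebra K.carrier A] [IsAlgClosure K.carrier A] [Field B] [Algebra A B]
    [Algebra (Polynomial A) B] [IsScalarTower A (Polynomial A) B]
    [IsFractionRing (Polynomial A) B] {w₁ w₂ F : K.carrier}
    (hw : ¬(w₁ = 0 ∧ w₂ = 0)) (hF : F ≠ 0) {p : ℕ} (hp : 0 < p)
    (h : K.d₁ F * w₂ - K.d₂ F * w₁ + (p : K.carrier) * F * (K.d₁ w₂ - K.d₂ w₁) = 0) :
    ∃ (E : DeltaField) (ι : K.carrier →+* E.carrier),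
      (∀ x, ι (K.d₁ x) = E.d₁ (ι x)) ∧ (∀ x, ι (K.d₂ x) = E.d₂ (ι x)) ∧
      DarbouxTower E ι.fieldRange ∧
      ∃ H : E.carrier,
        E.d₁ H * ι w₂ - E.d₂ H * ι w₁ = 0 ∧ ¬(E.d₁ H = 0 ∧ E.d₂ H = 0) := by
  have : IsAlgClosed A := IsAlgClosure.isAlgClosed K.carrier
  have : Algebra.IsAlgebraic K.carrier A := IsAlgClosure.isAlgebraic
  have : CharZero A := charZero_of_injective_algebraMap (algebraMap K.carrier A).injective
  let i : K.carrier →+* A := algebraMap K.carrier A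
  have : Algebra.FormallyEtale K.carrier A := Algebra.FormallyEtale.of_isSeparable _ _
  obtain ⟨e₁, he₁⟩ := Derivation.exists_extension_of_formallyEtale (T := A) K.der₁
  obtain ⟨e₂, he₂⟩ := Derivation.exists_extension_of_formallyEtale (T := A) K.der₂
  have hcomm : ∀ x, e₁ (e₂ x) = e₂ (e₁ x) :=
    Derivation.commute_of_formallyUnramified (S := K.carrier) e₁ e₂ fun s ↦ by
      simp [he₁, he₂, K.comm]
  obtain ⟨f, hf⟩ : ∃ f : A, f ^ p = i F := IsAlgClosed.exists_pow_nat_eq _ hp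
  have hf0 : f ≠ 0 := by
    rintro rfl
    rw [zero_pow hp.ne'] at hf
    exact hF (i.injective (by rw [← hf, map_zero]))
  have hroot (e : Derivation ℤ A A) : p * i F * e f = f * e (i F) := by
    rw [← hf, Derivation.leibniz_pow]
    obtain ⟨q, rfl⟩ := Nat.exists_eq_succ_of_ne_zero hp.ne'
    simp [pow_succ]
    ring
  have hclosed : e₁ (f * i w₂) = e₂ (f * i w₁) := by
    have hpF : (p : A) * i F ≠ 0 :=
      mul_ne_zero (Nat.cast_ne_zero.mpr hp.ne') ((map_ne_zero i).mpr hF)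
    have h' := congrArg i h
    simp only [map_add, map_sub, map_mul, map_natCast, map_zero] at h'
    have h₁ := hroot e₁
    have h₂ := hroot e₂
    apply mul_left_cancel₀ hpF
    simp only [i] at h₁ h₂ h' ⊢
    rw [he₁] at h₁
    rw [he₂] at h₂
    simp only [Derivation.leibniz, smul_eq_mul, he₁, he₂, DeltaField.der₁_apply,
      DeltaField.der₂_apply] at h₁ h₂ ⊢
    linear_combination f * h' + algebraMap K.carrier A w₂ * h₁ - algebraMap K.carrier A w₁ * h₂
  obtain ⟨D₁, hD₁, hD₁X⟩ := exists_derivation_fractionRing (B := B) e₁ (f * i w₁)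
  obtain ⟨D₂, hD₂, hD₂X⟩ := exists_derivation_fractionRing (B := B) e₂ (f * i w₂)
  let j : A →+* B := algebraMap A B
  have : CharZero B := charZero_of_injective_algebraMap (R := A) j.injective
  let E : DeltaField :=
    { carrier := B
      d₁ := D₁
      d₂ := D₂
      d₁_add := map_add D₁
      d₁_mul := fun x y ↦ by simp; ring
      d₂_add := map_add D₂
      d₂_mul := fun x y ↦ by simp; ring
      comm := commute_derivation_fractionRing D₁ D₂
        (fun a ↦ by rw [hD₁, hD₂, hD₁, hD₂, hcomm])
        (by rw [hD₁X, hD₂X, hD₁, hD₂, hclosed]) }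
  have hι₁ (x : K.carrier) : D₁ (j (i x)) = j (i (K.d₁ x)) := by
    rw [hD₁]; exact congrArg j (he₁ x)
  have hι₂ (x : K.carrier) : D₂ (j (i x)) = j (i (K.d₂ x)) := by
    rw [hD₂]; exact congrArg j (he₂ x)
  refine ⟨E, j.comp i, fun x ↦ (hι₁ x).symm, fun x ↦ (hι₂ x).symm, ?_,
    algebraMap (Polynomial A) B Polynomial.X, ?_, ?_⟩
  · refine ⟨2, ![(j.comp i).fieldRange, j.fieldRange, ⊤], rfl, rfl, ?_, ?_⟩
    · intro n
      fin_cases n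
      · rintro _ ⟨x, rfl⟩
        exact ⟨⟨_, (hι₁ x).symm⟩, ⟨_, (hι₂ x).symm⟩⟩
      · rintro _ ⟨x, rfl⟩
        exact ⟨⟨_, (hD₁ x).symm⟩, ⟨_, (hD₂ x).symm⟩⟩
      · exact fun x _ ↦ ⟨Subfield.mem_top _, Subfield.mem_top _⟩
    · intro n
      fin_cases n
      · refine ⟨?_, Or.inl ?_⟩
        · rintro _ ⟨x, rfl⟩
          exact ⟨i x, rfl⟩
        · rintro _ ⟨x, rfl⟩
          let : Algebra K.carrier E.carrier := (j.comp i).toAlgebra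
          let : Algebra A E.carrier := j.toAlgebra
          have : IsScalarTower K.carrier A E.carrier := IsScalarTower.of_algebraMap_eq fun _ ↦ rfl
          exact algebraicOver_of_isAlgebraic (F := K.carrier)
            ((Algebra.IsAlgebraic.isAlgebraic (R := K.carrier) x).algebraMap (A := E.carrier))
      · refine ⟨fun _ _ ↦ Subfield.mem_top _, Or.inr
          ⟨algebraMap (Polynomial A) B Polynomial.X, ⟨_, hD₁X.symm⟩, ⟨_, hD₂X.symm⟩, ?_⟩⟩
        exact (closure_fractionRing_eq_top A B).symm
  · change D₁ _ * j (i w₂) - D₂ _ * j (i w₁) = 0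
    rw [hD₁X, hD₂X, map_mul, map_mul]
    ring
  · rintro ⟨h₁, h₂⟩
    refine hw ⟨?_, ?_⟩
    · have h₁ : j (f * i w₁) = 0 := hD₁X.symm.trans h₁
      simpa [hf0] using h₁
    · have h₂ : j (f * i w₂) = 0 := hD₂X.symm.trans h₂
      simpa [hf0] using h₂

/-- a foliation `ω = (w₁, w₂)` over a Δ-field `K` admits a first
integral in a Darboux tower over `K` if and only if there is `F ∈ K`, `F ≠ 0`, and
`p > 0` with `δ₁F·w₂ − δ₂F·w₁ + p·F·(δ₁w₂ − δ₂w₁) = 0` (a `p`-th root of `F` is an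
integrating factor: a Godbillon-Vey sequence of length one). -/
theorem darboux_first_integral_iff_length_one_GV
    (K : DeltaField) (w₁ w₂ : K.carrier) (hw : ¬(w₁ = 0 ∧ w₂ = 0)) :
    (∃ (E : DeltaField) (ι : K.carrier →+* E.carrier),
      (∀ x, ι (K.d₁ x) = E.d₁ (ι x)) ∧ (∀ x, ι (K.d₂ x) = E.d₂ (ι x)) ∧
      DarbouxTower E ι.fieldRange ∧
      ∃ H : E.carrier,
        E.d₁ H * ι w₂ - E.d₂ H * ι w₁ = 0 ∧ ¬(E.d₁ H = 0 ∧ E.d₂ H = 0)) ↔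
    (∃ (F : K.carrier) (p : ℕ), F ≠ 0 ∧ 0 < p ∧
      K.d₁ F * w₂ - K.d₂ F * w₁ + (p : K.carrier) * F * (K.d₁ w₂ - K.d₂ w₁) = 0) := by
  constructor
  · rintro ⟨E, ι, h₁, h₂, hT, H, hH, hne⟩
    have hιw : ¬(ι w₁ = 0 ∧ ι w₂ = 0) := by simpa using hw
    obtain ⟨f, hf, hfw⟩ := exists_integratingFactor_of_firstIntegral hιw hH hne
    have hc : -(E.d₁ (ι w₂) - E.d₂ (ι w₁)) = ι (-(K.d₁ w₂ - K.d₂ w₁)) := by simp [h₁, h₂]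
    rw [hc] at hfw
    obtain ⟨_, ⟨F, rfl⟩, hF, p, hp, hFp⟩ :=
      hT.exists_exponential ⟨w₂, rfl⟩ (neg_mem ⟨w₁, rfl⟩) ⟨_, rfl⟩ hf hfw
    refine ⟨F, p, by simpa using hF, hp, ι.injective ?_⟩
    rw [← h₁, ← h₂] at hFp
    simp only [map_add, map_sub, map_mul, map_neg, map_natCast, map_zero] at hFp ⊢
    linear_combination hFp
  · rintro ⟨F, p, hF, hp, h⟩
    exact exists_firstIntegral_of_integratingFactor (AlgebraicClosure K.carrier)
      (FractionRing (Polynomial (AlgebraicClosure K.carrier))) hw hF hp h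
end
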